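/- Let A = ∫₀¹ (sin x − x)/x² dx and B = ∫₁^∞ (sin x)/x² dx. Then A + B = 1 − γ, where γ is the Euler–Mascheroni constant. -/

import Mathlib

open MeasureTheory

open Set Filter Topology

theorem Real.integral_exp_neg_mul_log :
    ∫ t in Ioi (0 : ℝ), Real.exp (-t) * Real.log t = -Real.eulerMascheroniConstant := by
  have h1 := Complex.hasDerivAt_GammaIntegral (s := 1) (by simp)
  have h2 : HasDerivAt Complex.GammaIntegral (-(Real.eulerMascheroniConstant : ℂ)) 1 := by
    refine Complex.hasDerivAt_Gamma_one.congr_of_eventuallyEq ?_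
    filter_upwards [(isOpen_lt continuous_const Complex.continuous_re).mem_nhds
      (show (0 : ℝ) < (1 : ℂ).re by simp)] with s hs
    exact (Complex.Gamma_eq_integral hs).symm
  have h3 := h1.unique h2
  apply Complex.ofReal_injective
  rw [Complex.ofReal_neg, ← h3, ← integral_complex_ofReal]
  refine integral_congr_ae (ae_of_all _ fun t => ?_)
  simp [mul_comm]

theorem Real.integrableOn_exp_neg_mul_log :
    IntegrableOn (fun t => Real.exp (-t) * Real.log t) (Ioi 0) := by
  by_contra h
  have h1 := Real.integral_exp_neg_mul_log
  rw [integral_undef h] at h1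
  linarith [Real.one_half_lt_eulerMascheroniConstant]

theorem integrableOn_mul_exp_neg_mul_Ioi {x : ℝ} (hx : 0 < x) :
    IntegrableOn (fun t : ℝ => t * Real.exp (-(x * t))) (Ioi 0) := by
  simpa using integrableOn_rpow_mul_exp_neg_mul_rpow (p := 1) (s := 1) (by norm_num) one_pos hx

theorem integral_mul_exp_neg_mul_Ioi {x : ℝ} (hx : 0 < x) :
    ∫ t in Ioi (0 : ℝ), t * Real.exp (-(x * t)) = 1 / x ^ 2 := by
  have h := Real.integral_rpow_mul_exp_neg_mul_Ioi (a := 2) two_pos hx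
  norm_num [Real.Gamma_two] at h
  simpa using h

theorem integrableOn_sin_mul_exp_neg_mul_Ioi {t : ℝ} (ht : 0 < t) :
    IntegrableOn (fun x : ℝ => Real.sin x * Real.exp (-(x * t))) (Ioi 0) := by
  refine (exp_neg_integrableOn_Ioi 0 ht).mono' (by fun_prop) (ae_of_all _ fun x => ?_)
  rw [norm_mul, Real.norm_eq_abs, Real.norm_eq_abs, Real.abs_exp,
    show -t * x = -(x * t) by ring]
  exact mul_le_of_le_one_left (Real.exp_pos _).le (Real.abs_sin_le_one x)

theorem integral_sin_mul_exp_neg_mul_Ioi {t : ℝ} (ht : 0 < t) :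
    ∫ x in Ioi (0 : ℝ), Real.sin x * Real.exp (-(x * t)) = 1 / (1 + t ^ 2) := by
  have ht2 : (1 + t ^ 2) ≠ 0 := by positivity
  have hd (x : ℝ) : HasDerivAt
      (fun x => -((t * Real.sin x + Real.cos x) * Real.exp (-(x * t))) / (1 + t ^ 2))
      (Real.sin x * Real.exp (-(x * t))) x := by
    have h1 := ((Real.hasDerivAt_sin x).const_mul t).add (Real.hasDerivAt_cos x)
    have h2 := ((hasDerivAt_id x).mul_const t).neg.exp
    refine ((h1.mul h2).neg.div_const (1 + t ^ 2)).congr_deriv ?_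
    simp only [id, Pi.add_apply, Pi.neg_apply]
    field_simp
    ring
  have hexp : Tendsto (fun x : ℝ => Real.exp (-(x * t))) atTop (𝓝 0) :=
    Real.tendsto_exp_neg_atTop_nhds_zero.comp (tendsto_id.atTop_mul_const ht)
  have hlim : Tendsto (fun x => -((t * Real.sin x + Real.cos x) * Real.exp (-(x * t))) /
      (1 + t ^ 2)) atTop (𝓝 0) := by
    have hz : Tendsto (fun x => (t * Real.sin x + Real.cos x) * Real.exp (-(x * t)))
        atTop (𝓝 0) := by
      refine squeeze_zero_norm (a := fun x => (t + 1) * Real.exp (-(x * t))) (fun x => ?_) ?_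
      · rw [norm_mul, Real.norm_eq_abs, Real.norm_eq_abs, Real.abs_exp]
        gcongr
        refine (abs_add_le _ _).trans ?_
        rw [abs_mul, abs_of_pos ht]
        exact add_le_add (mul_le_of_le_one_right ht.le (Real.abs_sin_le_one x))
          (Real.abs_cos_le_one x)
      · simpa using hexp.const_mul (t + 1)
    simpa using hz.neg.div_const (1 + t ^ 2)
  rw [integral_Ioi_of_hasDerivAt_of_tendsto' (fun x _ => hd x)
    (integrableOn_sin_mul_exp_neg_mul_Ioi ht) hlim]
  simp [neg_div]

theorem integral_mul_exp_neg_mul_Ioc {t : ℝ} (ht : 0 < t) :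
    ∫ x in Ioc (0 : ℝ) 1, x * Real.exp (-(x * t)) =
      (1 - Real.exp (-t) * (1 + t)) / t ^ 2 := by
  rw [← intervalIntegral.integral_of_le zero_le_one]
  have hd (x : ℝ) : HasDerivAt (fun x => -((x * t + 1) * Real.exp (-(x * t))) / t ^ 2)
      (x * Real.exp (-(x * t))) x := by
    have h0 := (hasDerivAt_id x).mul_const t
    refine (((h0.add_const 1).mul h0.neg.exp).neg.div_const (t ^ 2)).congr_deriv ?_
    simp only [id, Pi.neg_apply]
    field_simp
    ring
  rw [intervalIntegral.integral_eq_sub_of_hasDerivAt (fun x _ => hd x)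
    (Continuous.intervalIntegrable (by fun_prop) _ _)]
  simp
  ring

theorem integrableOn_sin_sub_self_div_sq :
    IntegrableOn (fun x : ℝ => (Real.sin x - x) / x ^ 2) (Ioc 0 1) := by
  refine Measure.integrableOn_of_bounded (M := 1) (by simp)
    (Measurable.aestronglyMeasurable (by fun_prop)) ?_
  filter_upwards [ae_restrict_mem measurableSet_Ioc] with x hx
  have h1 := Real.sin_lt hx.1
  have h2 := Real.sin_gt_sub_cube hx.1
  have h3 : x ^ 3 ≤ x ^ 2 := pow_le_pow_of_le_one hx.1.le hx.2 (by norm_num)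
  have h4 : 0 < x ^ 2 := pow_pos hx.1 2
  rw [Real.norm_eq_abs, abs_div, abs_of_pos h4, div_le_one h4, abs_of_neg (by linarith)]
  linarith

theorem integrableOn_sin_div_sq : IntegrableOn (fun x : ℝ => Real.sin x / x ^ 2) (Ioi 1) := by
  refine (integrableOn_Ioi_rpow_of_lt (a := -2) (by norm_num) one_pos).mono'
    (Measurable.aestronglyMeasurable (by fun_prop)) ?_
  filter_upwards [ae_restrict_mem measurableSet_Ioi] with x hx
  have hx0 : (0 : ℝ) < x := one_pos.trans hx
  rw [Real.rpow_neg hx0.le, Real.rpow_two, norm_div, Real.norm_eq_abs, norm_pow,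
    Real.norm_eq_abs, sq_abs, div_eq_mul_inv]
  exact mul_le_of_le_one_left (by positivity) (Real.abs_sin_le_one x)

/-- `sin x` minus the part of its linearization at `0` supported on `x ≤ 1`. -/
noncomputable def sinSubTruncId (x : ℝ) : ℝ := Real.sin x - (Iic (1 : ℝ)).indicator id x

theorem measurable_sinSubTruncId : Measurable sinSubTruncId :=
  Real.measurable_sin.sub (measurable_id.indicator measurableSet_Iic)

theorem sinSubTruncId_of_mem_Ioc {x : ℝ} (hx : x ∈ Ioc (0 : ℝ) 1) :
    sinSubTruncId x = Real.sin x - x := by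
  simp [sinSubTruncId, hx.2]

theorem sinSubTruncId_of_mem_Ioi {x : ℝ} (hx : x ∈ Ioi (1 : ℝ)) :
    sinSubTruncId x = Real.sin x := by
  simpa [sinSubTruncId] using fun h => absurd hx (not_lt.mpr h)

theorem integrableOn_sinSubTruncId_div_sq_Ioc :
    IntegrableOn (fun x => sinSubTruncId x / x ^ 2) (Ioc 0 1) :=
  integrableOn_sin_sub_self_div_sq.congr_fun
    (fun x hx => by simp only [sinSubTruncId_of_mem_Ioc hx]) measurableSet_Ioc

theorem integrableOn_sinSubTruncId_div_sq_Ioi_one :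
    IntegrableOn (fun x => sinSubTruncId x / x ^ 2) (Ioi 1) :=
  integrableOn_sin_div_sq.congr_fun
    (fun x hx => by simp only [sinSubTruncId_of_mem_Ioi hx]) measurableSet_Ioi

theorem integrableOn_sinSubTruncId_div_sq :
    IntegrableOn (fun x => sinSubTruncId x / x ^ 2) (Ioi 0) := by
  rw [← Ioc_union_Ioi_eq_Ioi (zero_le_one' ℝ)]
  exact integrableOn_sinSubTruncId_div_sq_Ioc.union integrableOn_sinSubTruncId_div_sq_Ioi_one

theorem integral_sinSubTruncId_div_sq :
    ∫ x in Ioi (0 : ℝ), sinSubTruncId x / x ^ 2 =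
      (∫ x in Ioo (0 : ℝ) 1, (Real.sin x - x) / x ^ 2) +
        ∫ x in Ioi (1 : ℝ), Real.sin x / x ^ 2 := by
  rw [← Ioc_union_Ioi_eq_Ioi (zero_le_one' ℝ), setIntegral_union Ioc_disjoint_Ioi_same
    measurableSet_Ioi integrableOn_sinSubTruncId_div_sq_Ioc
    integrableOn_sinSubTruncId_div_sq_Ioi_one, ← integral_Ioc_eq_integral_Ioo]
  congr 1
  · exact setIntegral_congr_fun measurableSet_Ioc
      fun x hx => by simp only [sinSubTruncId_of_mem_Ioc hx]
  · exact setIntegral_congr_fun measurableSet_Ioi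
      fun x hx => by simp only [sinSubTruncId_of_mem_Ioi hx]

theorem integral_sinSubTruncId_mul_exp {t : ℝ} (ht : 0 < t) :
    ∫ x in Ioi (0 : ℝ), sinSubTruncId x * (t * Real.exp (-(x * t))) =
      t / (1 + t ^ 2) - (1 - Real.exp (-t) * (1 + t)) / t := by
  have hind : ∀ x, (Iic (1 : ℝ)).indicator id x * Real.exp (-(x * t)) =
      (Iic (1 : ℝ)).indicator (fun x => x * Real.exp (-(x * t))) x := fun x => by
    by_cases hx : x ≤ 1 <;> simp [hx]
  have hint : IntegrableOn (fun x : ℝ => x * Real.exp (-(x * t))) (Ioi 0 ∩ Iic 1) := by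
    rw [Ioi_inter_Iic, ← integrableOn_Icc_iff_integrableOn_Ioc]
    exact Continuous.integrableOn_Icc (by fun_prop)
  have hint2 : IntegrableOn (fun x => (Iic (1 : ℝ)).indicator
      (fun x => x * Real.exp (-(x * t))) x) (Ioi 0) := by
    rw [IntegrableOn, integrable_indicator_iff measurableSet_Iic, IntegrableOn,
      Measure.restrict_restrict measurableSet_Iic, inter_comm]
    exact hint
  have hrw : ∀ x, sinSubTruncId x * (t * Real.exp (-(x * t))) =
      t * (Real.sin x * Real.exp (-(x * t)) -
        (Iic (1 : ℝ)).indicator (fun x => x * Real.exp (-(x * t))) x) := fun x => by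
    rw [← hind, sinSubTruncId]
    ring
  simp_rw [hrw]
  rw [integral_const_mul, integral_sub (integrableOn_sin_mul_exp_neg_mul_Ioi ht) hint2,
    integral_sin_mul_exp_neg_mul_Ioi ht, setIntegral_indicator measurableSet_Iic,
    Ioi_inter_Iic, integral_mul_exp_neg_mul_Ioc ht]
  field_simp

theorem integrable_sinSubTruncId_mul_exp_prod :
    Integrable (Function.uncurry fun x t : ℝ => sinSubTruncId x * (t * Real.exp (-(x * t))))
      ((volume.restrict (Ioi 0)).prod (volume.restrict (Ioi 0))) := by
  have hmeas : Measurable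
      (Function.uncurry fun x t : ℝ => sinSubTruncId x * (t * Real.exp (-(x * t)))) := by
    have := measurable_sinSubTruncId
    unfold Function.uncurry
    fun_prop
  rw [integrable_prod_iff hmeas.aestronglyMeasurable]
  refine ⟨?_, integrableOn_sinSubTruncId_div_sq.norm.congr ?_⟩
  · filter_upwards [ae_restrict_mem measurableSet_Ioi] with x hx
    exact (integrableOn_mul_exp_neg_mul_Ioi hx).const_mul (sinSubTruncId x)
  · filter_upwards [ae_restrict_mem measurableSet_Ioi] with x hx
    have h : ∀ t ∈ Ioi (0 : ℝ), ‖Function.uncurry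
        (fun x t : ℝ => sinSubTruncId x * (t * Real.exp (-(x * t)))) (x, t)‖ =
        |sinSubTruncId x| * (t * Real.exp (-(x * t))) := fun t ht => by
      have ht' : (0 : ℝ) < t := ht
      simp [Function.uncurry, abs_of_pos ht']
    rw [setIntegral_congr_fun measurableSet_Ioi h, integral_const_mul,
      integral_mul_exp_neg_mul_Ioi hx, norm_div, Real.norm_eq_abs, norm_pow, Real.norm_eq_abs,
      sq_abs]
    ring

theorem integral_sinSubTruncId_div_sq_eq :
    ∫ x in Ioi (0 : ℝ), sinSubTruncId x / x ^ 2 =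
      ∫ t in Ioi (0 : ℝ), (t / (1 + t ^ 2) - (1 - Real.exp (-t) * (1 + t)) / t) := by
  have h1 : ∀ x ∈ Ioi (0 : ℝ), sinSubTruncId x / x ^ 2 =
      ∫ t in Ioi (0 : ℝ), sinSubTruncId x * (t * Real.exp (-(x * t))) := fun x hx => by
    rw [integral_const_mul, integral_mul_exp_neg_mul_Ioi hx]
    ring
  rw [setIntegral_congr_fun measurableSet_Ioi h1,
    integral_integral_swap integrable_sinSubTruncId_mul_exp_prod]
  exact setIntegral_congr_fun measurableSet_Ioi fun t ht => integral_sinSubTruncId_mul_exp ht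

theorem integrableOn_laplace_sinSubTruncId :
    IntegrableOn (fun t : ℝ => t / (1 + t ^ 2) - (1 - Real.exp (-t) * (1 + t)) / t) (Ioi 0) := by
  have h := integrable_sinSubTruncId_mul_exp_prod.integral_prod_right
  refine h.congr ?_
  filter_upwards [ae_restrict_mem measurableSet_Ioi] with t ht
  exact integral_sinSubTruncId_mul_exp ht

theorem continuousWithinAt_one_sub_exp_neg_mul_log :
    ContinuousWithinAt (fun t => (1 - Real.exp (-t)) * Real.log t) (Ici 0) 0 := by
  have h : Tendsto (fun t : ℝ => |t * Real.log t|) (𝓝[Ici 0] 0) (𝓝 0) := by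
    have := (Real.continuous_mul_log.abs.tendsto 0).mono_left
      (nhdsWithin_le_nhds (s := Ici 0))
    simpa using this
  rw [ContinuousWithinAt]
  simp only [Real.log_zero, mul_zero]
  refine squeeze_zero_norm' ?_ h
  filter_upwards [self_mem_nhdsWithin] with t ht
  have ht0 : (0 : ℝ) ≤ t := ht
  rw [Real.norm_eq_abs, abs_mul, abs_mul]
  refine mul_le_mul_of_nonneg_right ?_ (abs_nonneg _)
  have h1 := Real.add_one_le_exp (-t)
  have h2 : Real.exp (-t) ≤ 1 := Real.exp_le_one_iff.mpr (by linarith)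
  rw [abs_of_nonneg (by linarith), abs_of_nonneg ht0]
  linarith

theorem tendsto_log_one_add_sq_div_two_sub_log :
    Tendsto (fun t : ℝ => Real.log (1 + t ^ 2) / 2 - Real.log t) atTop (𝓝 0) := by
  have h1 : Tendsto (fun t : ℝ => Real.log (1 + (t ^ 2)⁻¹) / 2) atTop (𝓝 0) := by
    have h2 : Tendsto (fun t : ℝ => 1 + (t ^ 2)⁻¹) atTop (𝓝 1) := by
      simpa using (tendsto_inv_atTop_zero.comp
        (tendsto_pow_atTop (α := ℝ) (two_ne_zero))).const_add 1
    simpa using (h2.log one_ne_zero).div_const 2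
  refine h1.congr' ?_
  filter_upwards [eventually_gt_atTop 0] with t ht
  have : 1 + (t ^ 2)⁻¹ = (1 + t ^ 2) / t ^ 2 := by
    field_simp
    ring
  rw [this, Real.log_div (by positivity) (by positivity), Real.log_pow]
  push_cast
  ring

theorem tendsto_exp_neg_mul_log_atTop :
    Tendsto (fun t : ℝ => Real.exp (-t) * Real.log t) atTop (𝓝 0) := by
  have h : Tendsto (fun t : ℝ => t * Real.exp (-t)) atTop (𝓝 0) := by
    simpa using Real.tendsto_pow_mul_exp_neg_atTop_nhds_zero 1
  refine squeeze_zero_norm' ?_ h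
  filter_upwards [eventually_ge_atTop 1] with t ht
  rw [norm_mul, Real.norm_eq_abs, Real.norm_eq_abs, Real.abs_exp,
    abs_of_nonneg (Real.log_nonneg ht), mul_comm]
  gcongr
  exact Real.log_le_self (by linarith)

theorem integral_laplace_sinSubTruncId_sub :
    ∫ t in Ioi (0 : ℝ), ((t / (1 + t ^ 2) - (1 - Real.exp (-t) * (1 + t)) / t) -
      Real.exp (-t) * Real.log t) = 1 := by
  have hcont : ContinuousWithinAt (fun t : ℝ => Real.log (1 + t ^ 2) / 2 -
      (1 - Real.exp (-t)) * Real.log t - Real.exp (-t)) (Ici 0) 0 := by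
    refine (ContinuousAt.continuousWithinAt ?_ |>.sub
      continuousWithinAt_one_sub_exp_neg_mul_log).sub (by fun_prop)
    exact ((by fun_prop : ContinuousAt (fun t : ℝ => 1 + t ^ 2) 0).log (by simp)).div_const 2
  have hderiv : ∀ t ∈ Ioi (0 : ℝ), HasDerivAt (fun t : ℝ => Real.log (1 + t ^ 2) / 2 -
      (1 - Real.exp (-t)) * Real.log t - Real.exp (-t))
      ((t / (1 + t ^ 2) - (1 - Real.exp (-t) * (1 + t)) / t) - Real.exp (-t) * Real.log t) t := by
    intro t ht
    have ht0 : t ≠ 0 := ne_of_gt ht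
    have ht2 : 1 + t ^ 2 ≠ 0 := by positivity
    have he := (hasDerivAt_neg t).exp
    refine ((((((hasDerivAt_pow 2 t).const_add 1).log ht2).div_const 2).sub
      ((he.const_sub 1).mul (Real.hasDerivAt_log ht0))).sub he).congr_deriv ?_
    field_simp
    ring
  have hlim : Tendsto (fun t : ℝ => Real.log (1 + t ^ 2) / 2 -
      (1 - Real.exp (-t)) * Real.log t - Real.exp (-t)) atTop (𝓝 0) := by
    have h := (tendsto_log_one_add_sq_div_two_sub_log.add tendsto_exp_neg_mul_log_atTop).sub
      Real.tendsto_exp_neg_atTop_nhds_zero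
    rw [add_zero, sub_zero] at h
    refine h.congr fun t => ?_
    ring
  rw [integral_Ioi_of_hasDerivAt_of_tendsto hcont hderiv
    (integrableOn_laplace_sinSubTruncId.sub Real.integrableOn_exp_neg_mul_log) hlim]
  simp

/-- `∫₀¹ (sin x − x)/x² dx + ∫₁^∞ (sin x)/x² dx = 1 − γ`. -/
theorem sin_integrals_add_eq_one_sub_eulerMascheroni :
    (∫ x in Set.Ioo (0 : ℝ) 1, (Real.sin x - x) / x ^ 2) +
      (∫ x in Set.Ioi (1 : ℝ), Real.sin x / x ^ 2) =
    1 - Real.eulerMascheroniConstant := by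
  have h := integral_laplace_sinSubTruncId_sub
  rw [integral_sub integrableOn_laplace_sinSubTruncId Real.integrableOn_exp_neg_mul_log,
    Real.integral_exp_neg_mul_log, ← integral_sinSubTruncId_div_sq_eq,
    integral_sinSubTruncId_div_sq] at h
  linarith
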